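/- Let N ≥ 4 be an integer and let p₁, …, p_m be distinct partitions of [k], each having at least one crossing, such that cr(p_i) = cr(p_j) for all 1 ≤ i, j ≤ m. Then the vectors ξ_{p₁}, …, ξ_{p_m} ∈ ((Fin k → Fin N) → ℂ) are linearly independent. -/

import Mathlib

open scoped Classical

/-- The block relation of a finite partition of `Fin n` (partition of `[n]`):
`x ∼_p y` iff `x` and `y` lie in the same block of `p`. -/
def PartRel {n : ℕ} (p : Finpartition (Finset.univ : Finset (Fin n))) (x y : Fin n) : Prop :=
  ∃ B ∈ p.parts, x ∈ B ∧ y ∈ B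

/-- `κ` is a crossing of the relation `r`: `κ = {a,b,c,d}` with `a < b < c < d`,
`r a c`, `r b d`, and `¬ r a b`. -/
def IsCross {n : ℕ} (r : Fin n → Fin n → Prop) (κ : Finset (Fin n)) : Prop :=
  ∃ a b c d : Fin n, a < b ∧ b < c ∧ c < d ∧ κ = {a, b, c, d} ∧ r a c ∧ r b d ∧ ¬ r a b

/-- `cr p`: the set of crossings of the partition `p`. -/
def cr {n : ℕ} (p : Finpartition (Finset.univ : Finset (Fin n))) : Set (Finset (Fin n)) :=
  {κ | IsCross (PartRel p) κ}


/-- `crossers p` (`χ(p)`): the union of all crossings of `p`. -/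
def crossers {n : ℕ} (p : Finpartition (Finset.univ : Finset (Fin n))) : Set (Fin n) :=
  {x | ∃ κ ∈ cr p, x ∈ κ}

/-- The vector `ξ_p ∈ (ℂ^N)^{⊗k}`, identified with `(Fin k → Fin N) → ℂ`:
its coordinate at `i` is `1` if `i` is constant on every block of `p`, else `0`. -/
noncomputable def xi (N : ℕ) {k : ℕ} (p : Finpartition (Finset.univ : Finset (Fin k))) :
    (Fin k → Fin N) → ℂ :=
  fun i => if ∀ x y, PartRel p x y → i x = i y then 1 else 0

/-- The span of the noncrossing-partition vectors `ξ_p`, `p ∈ NC(k)`. -/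
noncomputable def ncSpan (N k : ℕ) : Submodule ℂ ((Fin k → Fin N) → ℂ) :=
  Submodule.span ℂ
    {v | ∃ p : Finpartition (Finset.univ : Finset (Fin k)), cr p = ∅ ∧ v = xi N p}

/-- The span of the crossing-partition vectors `ξ_p`, `p ∈ CR(k)`. -/
noncomputable def crSpan (N k : ℕ) : Submodule ℂ ((Fin k → Fin N) → ℂ) :=
  Submodule.span ℂ
    {v | ∃ p : Finpartition (Finset.univ : Finset (Fin k)), (cr p).Nonempty ∧ v = xi N p}

/-- The span of all partition vectors `ξ_p`, `p ∈ P(k)`. -/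
noncomputable def allSpan (N k : ℕ) : Submodule ℂ ((Fin k → Fin N) → ℂ) :=
  Submodule.span ℂ
    {v | ∃ p : Finpartition (Finset.univ : Finset (Fin k)), v = xi N p}

/-! ### A triangularity criterion for linear independence -/

theorem linearIndependent_of_triangular {ι V K α : Type*} [Fintype ι] [Field K] [AddCommGroup V]
    [Module K V] [LinearOrder α] (v : ι → V) (φ : ι → V →ₗ[K] K) (w : ι → α)
    (hw : Function.Injective w) (hdiag : ∀ i, φ i (v i) ≠ 0)
    (htri : ∀ i j, φ i (v j) ≠ 0 → w j ≤ w i) : LinearIndependent K v := by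
  rw [Fintype.linearIndependent_iff]
  intro c hc
  by_contra! hne
  obtain ⟨i₀, hi₀⟩ := hne
  obtain ⟨i, hi, hmin⟩ := Finset.exists_min_image (Finset.univ.filter fun i => c i ≠ 0) w
    ⟨i₀, by simpa using hi₀⟩
  have hci : c i ≠ 0 := by simpa using hi
  have h := congrArg (φ i) hc
  rw [map_sum, map_zero, Finset.sum_eq_single i] at h
  · simp [hci, hdiag i] at h
  · intro j _ hji
    rw [map_smul, smul_eq_mul]
    by_contra hne
    obtain ⟨h1, h2⟩ := mul_ne_zero_iff.mp hne
    exact hji (hw (le_antisymm (htri i j h2) (hmin j (by simpa using h1))))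
  · simp

/-! ### Noncrossing equivalence relations on a finite linear order -/

section Noncrossing

variable {ι : Type*} [LinearOrder ι]

/-- No two distinct classes of `r` cross. -/
def IsNoncrossing (r : Setoid ι) : Prop :=
  ∀ a b c d, a < b → b < c → c < d → r a c → r b d → r a b

/-- `i` is the least element of its class. -/
def IsFirst (r : Setoid ι) (i : ι) : Prop := ∀ j, j < i → ¬ r j i

/-- `i` is the greatest element of its class. -/
def IsLast (r : Setoid ι) (i : ι) : Prop := ∀ j, i < j → ¬ r i j

/-- Encodes whether `i` is first, respectively last, in its class. -/
noncomputable def endKey (r : Setoid ι) (i : ι) : ℕ :=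
  (if IsFirst r i then 0 else 2) + (if IsLast r i then 1 else 0)

theorem endKey_eq_iff {p q : Setoid ι} {i : ι} :
    endKey p i = endKey q i ↔ (IsFirst p i ↔ IsFirst q i) ∧ (IsLast p i ↔ IsLast q i) := by
  unfold endKey
  split_ifs <;> simp_all

theorem endKey_lt_iff {p q : Setoid ι} {i : ι} : endKey p i < endKey q i ↔
    (IsFirst p i ∧ ¬ IsFirst q i) ∨ ((IsFirst p i ↔ IsFirst q i) ∧ ¬ IsLast p i ∧ IsLast q i) := by
  unfold endKey
  split_ifs <;> simp_all

variable [Fintype ι]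

theorem exists_isFirst (r : Setoid ι) (x : ι) : ∃ f, f ≤ x ∧ r x f ∧ IsFirst r f := by
  obtain ⟨f, hf, hmin⟩ := Finset.exists_min_image (Finset.univ.filter fun j => r x j) id
    ⟨x, by simp⟩
  simp only [Finset.mem_filter, Finset.mem_univ, true_and, id] at hf hmin
  exact ⟨f, hmin x (r.refl x), hf, fun j hj hjf =>
    absurd (hmin j (r.trans hf (r.symm hjf))) (not_le.mpr hj)⟩

theorem exists_isLast (r : Setoid ι) (x : ι) : ∃ l, x ≤ l ∧ r x l ∧ IsLast r l := by
  obtain ⟨f, hf, hmax⟩ := Finset.exists_max_image (Finset.univ.filter fun j => r x j) id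
    ⟨x, by simp⟩
  simp only [Finset.mem_filter, Finset.mem_univ, true_and, id] at hf hmax
  exact ⟨f, hmax x (r.refl x), hf, fun j hj hjf =>
    absurd (hmax j (r.trans hf hjf)) (not_le.mpr hj)⟩

theorem exists_pred {r : Setoid ι} {i : ι} (hi : ¬ IsFirst r i) :
    ∃ h, h < i ∧ r h i ∧ ∀ j, h < j → j < i → ¬ r j i := by
  simp only [IsFirst, not_forall, not_not] at hi
  obtain ⟨x, hxi, hx⟩ := hi
  obtain ⟨h, hh, hmax⟩ := Finset.exists_max_image (Finset.univ.filter fun j => j < i ∧ r j i) id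
    ⟨x, by simpa using ⟨hxi, hx⟩⟩
  simp only [Finset.mem_filter, Finset.mem_univ, true_and, id] at hh hmax
  exact ⟨h, hh.1, hh.2, fun j hj hji hr => absurd (hmax j ⟨hji, hr⟩) (not_le.mpr hj)⟩

/-! ### A noncrossing relation is determined by its first and last elements -/

theorem IsNoncrossing.pred_le {p q : Setoid ι} (hp : IsNoncrossing p)
    (hlast : ∀ i, IsLast p i ↔ IsLast q i) {y i h : ι}
    (ih : ∀ y' < y, ∀ x < y', (p x y' ↔ q x y'))
    (hi : i < y) (hpi : p i y) (hi' : ∀ j, i < j → j < y → ¬ p j y)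
    (hh : h < y) (hqh : q h y) (hh' : ∀ j, h < j → j < y → ¬ q j y) : h ≤ i := by
  by_contra! hlt
  have hl : ¬ IsLast p h := fun hc => (hlast h).mp hc y hh hqh
  simp only [IsLast, not_forall, not_not] at hl
  obtain ⟨g, hhg, hpg⟩ := hl
  rcases lt_trichotomy g y with hgy | rfl | hyg
  · exact hh' g hhg hgy (q.trans (q.symm ((ih g hgy h hhg).mp hpg)) hqh)
  · exact hi' h hlt hh hpg
  · exact hi' h hlt hh (p.trans (p.symm (hp i h y g hlt hh hyg hpi hpg)) hpi)

theorem IsNoncrossing.eq_of_endKey_eq {p q : Setoid ι} (hp : IsNoncrossing p)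
    (hq : IsNoncrossing q) (h : endKey p = endKey q) : p = q := by
  have hfirst i : IsFirst p i ↔ IsFirst q i := (endKey_eq_iff.mp (congrFun h i)).1
  have hlast i : IsLast p i ↔ IsLast q i := (endKey_eq_iff.mp (congrFun h i)).2
  have key : ∀ y, ∀ x < y, (p x y ↔ q x y) := by
    intro y
    induction y using WellFoundedLT.induction with
    | ind y ih =>
    by_cases hy : IsFirst p y
    · exact fun x hx => iff_of_false (hy x hx) ((hfirst y).mp hy x hx)
    obtain ⟨i, hi, hpi, hi'⟩ := exists_pred hy
    obtain ⟨g, hg, hqg, hg'⟩ := exists_pred (mt (hfirst y).mpr hy)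
    have hgi : g ≤ i := hp.pred_le hlast ih hi hpi hi' hg hqg hg'
    have hig : i ≤ g := hq.pred_le (fun i => (hlast i).symm)
      (fun y' hy' x hx => (ih y' hy' x hx).symm) hg hqg hg' hi hpi hi'
    obtain rfl := le_antisymm hgi hig
    intro x hx
    rcases lt_trichotomy x g with hxg | rfl | hgx
    · constructor
      · exact fun hr => q.trans ((ih g hi x hxg).mp (p.trans hr (p.symm hpi))) hqg
      · exact fun hr => p.trans ((ih g hi x hxg).mpr (q.trans hr (q.symm hqg))) hpi
    · exact iff_of_true hpi hqg
    · exact iff_of_false (hi' x hgx hx) (hg' x hgx hx)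
  ext x y
  rcases lt_trichotomy x y with hxy | rfl | hxy
  · exact key y x hxy
  · exact iff_of_true (p.refl x) (q.refl x)
  · exact ⟨fun hr => q.symm ((key x y hxy).mp (p.symm hr)),
      fun hr => p.symm ((key x y hxy).mpr (q.symm hr))⟩

/-! ### Sums over saturated sets -/

theorem sum_eq_zero_of_saturated {ι : Type*} [Fintype ι] {M : Type*} [AddCommMonoid M]
    (r : Setoid ι) (α : ι → M)
    (hα : ∀ x, ∑ j ∈ Finset.univ.filter (fun j => r x j), α j = 0) (S : Finset ι)
    (hS : ∀ j ∈ S, ∀ j', r j j' → j' ∈ S) : ∑ j ∈ S, α j = 0 := by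
  rw [Finset.sum_partition r]
  refine Finset.sum_eq_zero fun c hc => ?_
  obtain ⟨x, hx, rfl⟩ := Finset.mem_image.mp hc
  rw [← hα x]
  refine Finset.sum_congr ?_ fun _ _ => rfl
  ext j
  simp only [Finset.mem_filter, Finset.mem_univ, true_and]
  constructor
  · exact fun h => r.symm (Quotient.exact h.2)
  · exact fun h => ⟨hS x hx j h, Quotient.sound (r.symm h)⟩

/-- The indicator of not being first. -/
noncomputable def leftLeg (r : Setoid ι) (i : ι) : ZMod 2 := if IsFirst r i then 0 else 1

/-- The indicator of not being last. -/
noncomputable def rightLeg (r : Setoid ι) (i : ι) : ZMod 2 := if IsLast r i then 0 else 1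

/-- The indicator of being an endpoint of a class with at least two elements. -/
noncomputable def endpointInd (r : Setoid ι) (i : ι) : ZMod 2 := leftLeg r i + rightLeg r i

/-- For noncrossing `r`, the parity of the number of classes of `r` that enclose `i`. -/
noncomputable def depthParity (r : Setoid ι) (i : ι) : ZMod 2 :=
  rightLeg r i + ∑ j ∈ Finset.univ.filter (fun j => i < j), endpointInd r j

theorem sum_endpointInd_class (r : Setoid ι) (x : ι) :
    ∑ j ∈ Finset.univ.filter (fun j => r x j), endpointInd r j = 0 := by
  obtain ⟨f, -, hxf, hf⟩ := exists_isFirst r x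
  obtain ⟨l, -, hxl, hl⟩ := exists_isLast r x
  have h : ∀ j ∈ Finset.univ.filter (fun j => r x j),
      endpointInd r j = (if j = f then 1 else 0) + (if j = l then 1 else 0) := by
    intro j hj
    have hxj : r x j := by simpa using hj
    have h1 : IsFirst r j ↔ j = f := by
      refine ⟨fun h => ?_, fun h => h ▸ hf⟩
      rcases lt_trichotomy j f with h' | h' | h'
      · exact absurd (r.trans (r.symm hxj) hxf) (hf j h')
      · exact h'
      · exact absurd (r.trans (r.symm hxf) hxj) (h f h')
    have h2 : IsLast r j ↔ j = l := by
      refine ⟨fun h => ?_, fun h => h ▸ hl⟩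
      rcases lt_trichotomy j l with h' | h' | h'
      · exact absurd (r.trans (r.symm hxj) hxl) (h l h')
      · exact h'
      · exact absurd (r.trans (r.symm hxl) hxj) (hl j h')
    simp only [endpointInd, leftLeg, rightLeg, h1, h2]
    split_ifs <;> decide
  rw [Finset.sum_congr rfl h, Finset.sum_add_distrib, Finset.sum_ite_eq', Finset.sum_ite_eq',
    if_pos (by simpa using hxf), if_pos (by simpa using hxl)]
  decide

theorem filter_lt_eq_union {i i' : ι} (h : i < i') :
    Finset.univ.filter (fun j => i < j) =
      Finset.univ.filter (fun j => i < j ∧ j ≤ i') ∪ Finset.univ.filter (fun j => i' < j) := by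
  ext j
  simp only [Finset.mem_filter, Finset.mem_univ, true_and, Finset.mem_union]
  constructor
  · intro hj
    rcases le_or_gt j i' with h' | h'
    · exact .inl ⟨hj, h'⟩
    · exact .inr h'
  · rintro (h' | h')
    · exact h'.1
    · exact h.trans h'

theorem sum_filter_lt {M : Type*} [AddCommMonoid M] (α : ι → M) {i i' : ι} (h : i < i') :
    ∑ j ∈ Finset.univ.filter (fun j => i < j), α j =
      ∑ j ∈ Finset.univ.filter (fun j => i < j ∧ j ≤ i'), α j +
        ∑ j ∈ Finset.univ.filter (fun j => i' < j), α j := by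
  rw [filter_lt_eq_union h, Finset.sum_union]
  rw [Finset.disjoint_left]
  intro j hj hj'
  simp only [Finset.mem_filter, Finset.mem_univ, true_and] at hj hj'
  exact absurd hj.2 (not_le.mpr hj')

theorem sum_filter_lt_le {M : Type*} [AddCommMonoid M] (α : ι → M) {i i' : ι} (h : i < i') :
    ∑ j ∈ Finset.univ.filter (fun j => i < j ∧ j ≤ i'), α j =
      α i' + ∑ j ∈ Finset.univ.filter (fun j => i < j ∧ j < i'), α j := by
  rw [← Finset.sum_insert (by simp)]
  refine Finset.sum_congr ?_ fun _ _ => rfl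
  ext j
  simp only [Finset.mem_filter, Finset.mem_univ, true_and, Finset.mem_insert, le_iff_lt_or_eq]
  constructor
  · rintro ⟨h1, h2 | h2⟩
    · exact .inr ⟨h1, h2⟩
    · exact .inl h2
  · rintro (rfl | h1)
    · exact ⟨h, .inr rfl⟩
    · exact ⟨h1.1, .inl h1.2⟩

theorem IsNoncrossing.depthParity_eq_of_lt {p : Setoid ι} (hp : IsNoncrossing p) {i i' : ι}
    (hlt : i < i') (h : p i i') : depthParity p i = depthParity p i' := by
  have hsum : ∑ j ∈ Finset.univ.filter (fun j => i < j ∧ j ≤ i'), endpointInd p j =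
      endpointInd p i' := by
    rw [← Finset.sum_filter_add_sum_filter_not _ (fun j => p i j)]
    rw [sum_eq_zero_of_saturated p _ (sum_endpointInd_class p)
      (Finset.filter (fun j => ¬ p i j) _), add_zero]
    · refine Finset.sum_eq_single i' ?_ ?_
      · intro j hj hne
        simp only [Finset.mem_filter, Finset.mem_univ, true_and] at hj
        have h1 : ¬ IsFirst p j := fun hf => hf i hj.1.1 hj.2
        have h2 : ¬ IsLast p j := fun hl =>
          hl i' (lt_of_le_of_ne hj.1.2 hne) (p.trans (p.symm hj.2) h)
        simp only [endpointInd, leftLeg, rightLeg, h1, h2, if_false]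
        decide
      · intro hn
        simp [hlt, h] at hn
    · intro j hj j' hjj'
      simp only [Finset.mem_filter, Finset.mem_univ, true_and] at hj ⊢
      obtain ⟨⟨hij, hji'⟩, hn⟩ := hj
      have hn' : ¬ p i j' := fun hc => hn (p.trans hc (p.symm hjj'))
      have hji' : j < i' := lt_of_le_of_ne hji' (by rintro rfl; exact hn h)
      refine ⟨⟨?_, ?_⟩, hn'⟩
      · by_contra! hle
        have hlt' : j' < i := lt_of_le_of_ne hle (by rintro rfl; exact hn' (p.refl _))
        exact hn' (p.symm (hp j' i j i' hlt' hij hji' (p.symm hjj') h))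
      · by_contra! hlt'
        exact hn (hp i j i' j' hij hji' hlt' h hjj')
  have h1 : ¬ IsFirst p i' := fun hf => hf i hlt h
  have h2 : ¬ IsLast p i := fun hl => hl i' hlt h
  unfold depthParity
  rw [sum_filter_lt _ hlt, hsum, ← add_assoc]
  congr 1
  simp only [endpointInd, leftLeg, rightLeg, h1, h2, if_false]
  split_ifs <;> decide

theorem IsNoncrossing.depthParity_eq {p : Setoid ι} (hp : IsNoncrossing p) {i i' : ι}
    (h : p i i') : depthParity p i = depthParity p i' := by
  rcases lt_trichotomy i i' with hlt | rfl | hlt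
  · exact hp.depthParity_eq_of_lt hlt h
  · rfl
  · exact (hp.depthParity_eq_of_lt hlt (p.symm h)).symm

theorem IsNoncrossing.rightLeg_eq_leftLeg {p q : Setoid ι} (hq : IsNoncrossing q)
    (hz : ∀ x y, q x y → depthParity p x = depthParity p y)
    (hα : ∀ x, ∑ j ∈ Finset.univ.filter (fun j => q x j), endpointInd p j = 0)
    {h i : ι} (hlt : h < i) (hhi : q h i) (hcons : ∀ j, h < j → j < i → ¬ q j i) :
    rightLeg p h = leftLeg p i := by
  have hsum : ∑ j ∈ Finset.univ.filter (fun j => h < j ∧ j < i), endpointInd p j = 0 := by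
    refine sum_eq_zero_of_saturated q _ hα _ fun j hj j' hjj' => ?_
    simp only [Finset.mem_filter, Finset.mem_univ, true_and] at hj ⊢
    have hn := hcons j hj.1 hj.2
    constructor
    · by_contra! hle
      rcases hle.lt_or_eq with h' | rfl
      · exact hn (q.trans hjj' (q.trans (hq j' h j i h' hj.1 hj.2 (q.symm hjj') hhi) hhi))
      · exact hn (q.trans hjj' hhi)
    · by_contra! hle
      rcases hle.lt_or_eq with h' | rfl
      · exact hn (q.trans (q.symm (hq h j i j' hj.1 hj.2 h' hhi hjj')) hhi)
      · exact hn hjj'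
  have hzz := hz h i hhi
  unfold depthParity at hzz
  rw [sum_filter_lt _ hlt, sum_filter_lt_le _ hlt, hsum, add_zero, ← add_assoc] at hzz
  replace hzz := add_right_cancel hzz
  unfold endpointInd at hzz
  generalize rightLeg p h = a at *
  generalize leftLeg p i = b at *
  generalize rightLeg p i = c at *
  revert a b c
  decide

theorem IsNoncrossing.leftLeg_eq_rightLeg {p q : Setoid ι} (hq : IsNoncrossing q)
    (hz : ∀ x y, q x y → depthParity p x = depthParity p y)
    (hα : ∀ x, ∑ j ∈ Finset.univ.filter (fun j => q x j), endpointInd p j = 0)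
    {f l : ι} (hle : f ≤ l) (hfl : q f l) (hf : IsFirst q f) (hl : IsLast q l) :
    leftLeg p f = rightLeg p l := by
  have hsum : ∑ j ∈ Finset.univ.filter (fun j => f ≤ j ∧ j ≤ l), endpointInd p j = 0 := by
    refine sum_eq_zero_of_saturated q _ hα _ fun j hj j' hjj' => ?_
    simp only [Finset.mem_filter, Finset.mem_univ, true_and] at hj ⊢
    constructor
    · by_contra! h'
      have hn := hf j' h'
      rcases hj.1.lt_or_eq with h1 | rfl
      · rcases hj.2.lt_or_eq with h2 | rfl
        · exact hn (hq j' f j l h' h1 h2 (q.symm hjj') hfl)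
        · exact hn (q.trans (q.symm hjj') (q.symm hfl))
      · exact hn (q.symm hjj')
    · by_contra! h'
      have hn := hl j' h'
      rcases hj.1.lt_or_eq with h1 | rfl
      · rcases hj.2.lt_or_eq with h2 | rfl
        · exact hn (q.trans (q.symm hfl) (q.trans (hq f j l j' h1 h2 h' hfl hjj') hjj'))
        · exact hn hjj'
      · exact hn (q.trans (q.symm hfl) hjj')
  have hzz := hz f l hfl
  rcases hle.lt_or_eq with hlt | rfl
  · have hsplit : Finset.univ.filter (fun j => f ≤ j ∧ j ≤ l) =
        insert f (Finset.univ.filter (fun j => f < j ∧ j ≤ l)) := by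
      ext j
      simp only [Finset.mem_filter, Finset.mem_univ, true_and, Finset.mem_insert]
      constructor
      · rintro ⟨h1, h2⟩
        rcases h1.lt_or_eq with h1 | rfl
        · exact .inr ⟨h1, h2⟩
        · exact .inl rfl
      · rintro (rfl | h1)
        · exact ⟨le_rfl, hle⟩
        · exact ⟨h1.1.le, h1.2⟩
    rw [hsplit, Finset.sum_insert (by simp)] at hsum
    unfold depthParity at hzz
    rw [sum_filter_lt _ hlt, ← add_assoc] at hzz
    replace hzz := add_right_cancel hzz
    generalize (∑ j ∈ Finset.univ.filter (fun j => f < j ∧ j ≤ l), endpointInd p j) = s at *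
    unfold endpointInd at hsum
    generalize rightLeg p f = a at *
    generalize leftLeg p f = b at *
    generalize rightLeg p l = c at *
    revert a b c s
    decide
  · have : Finset.univ.filter (fun j => f ≤ j ∧ j ≤ f) = {f} := by
      ext j
      simp [le_antisymm_iff, and_comm]
    rw [this, Finset.sum_singleton] at hsum
    unfold endpointInd at hsum
    generalize rightLeg p f = a at *
    generalize leftLeg p f = b at *
    revert a b
    decide

theorem IsNoncrossing.toLex_endKey_le {p q : Setoid ι} (hq : IsNoncrossing q)
    (hz : ∀ x y, q x y → depthParity p x = depthParity p y)
    (hα : ∀ x, ∑ j ∈ Finset.univ.filter (fun j => q x j), endpointInd p j = 0) :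
    toLex (endKey q) ≤ toLex (endKey p) := by
  by_contra! hlt
  obtain ⟨i, hbelow, hi⟩ := hlt
  have hbelow : ∀ j < i, endKey p j = endKey q j := hbelow
  have hi : endKey p i < endKey q i := hi
  rcases endKey_lt_iff.mp hi with ⟨h1, h2⟩ | ⟨h1, h2, h3⟩
  · obtain ⟨h, hh, hqh, hcons⟩ := exists_pred h2
    have h3 : ¬ IsLast p h := fun hl =>
      (endKey_eq_iff.mp (hbelow h hh)).2.mp hl i hh hqh
    have := hq.rightLeg_eq_leftLeg hz hα hh hqh hcons
    simp [rightLeg, leftLeg, h1, h3] at this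
  · obtain ⟨f, hfi, hqf, hf⟩ := exists_isFirst q i
    have h4 : IsFirst p f := by
      rcases hfi.lt_or_eq with hlt | rfl
      · exact (endKey_eq_iff.mp (hbelow f hlt)).1.mpr hf
      · exact h1.mpr hf
    have := hq.leftLeg_eq_rightLeg hz hα hfi (q.symm hqf) hf h3
    simp [rightLeg, leftLeg, h4, h2] at this

/-! ### Linear independence of noncrossing partition vectors -/

/-- The sign character of `ZMod 2`. -/
def parSign (a : ZMod 2) : ℂ := if a = 0 then 1 else -1

theorem parSign_add_one (a : ZMod 2) : parSign (a + 1) = - parSign a := by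
  have h01 : a = 0 ∨ a = 1 := by
    revert a
    decide
  have h2 : (1 + 1 : ZMod 2) = 0 := by decide
  rcases h01 with rfl | rfl <;> simp [parSign, h2]

/-- The indicator function of the tuples constant on the classes of `r`. -/
noncomputable def setoidVec {ι : Type*} (X : Type*) (r : Setoid ι) : (ι → X) → ℂ :=
  fun i => if ∀ x y, r x y → i x = i y then 1 else 0

/-- Fix the second coordinate to `z` and take the Fourier coefficient at `α` in the first one. -/
noncomputable def twistedFunctional {ι X : Type*} [Fintype ι] (e : ZMod 2 × ZMod 2 → X)
    (α z : ι → ZMod 2) : ((ι → X) → ℂ) →ₗ[ℂ] ℂ :=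
  ∑ y : ι → ZMod 2, parSign (∑ i, α i * y i) • LinearMap.proj (fun i => e (y i, z i))

theorem twistedFunctional_apply {ι X : Type*} [Fintype ι] (e : ZMod 2 × ZMod 2 → X)
    (α z : ι → ZMod 2) (f : (ι → X) → ℂ) :
    twistedFunctional e α z f =
      ∑ y : ι → ZMod 2, parSign (∑ i, α i * y i) * f (fun i => e (y i, z i)) := by
  simp [twistedFunctional]

theorem setoidVec_apply_prod {ι X : Type*} {e : ZMod 2 × ZMod 2 → X} (he : Function.Injective e)
    (r : Setoid ι) (y z : ι → ZMod 2) :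
    setoidVec X r (fun i => e (y i, z i)) =
      if (∀ a b, r a b → y a = y b) ∧ (∀ a b, r a b → z a = z b) then 1 else 0 := by
  unfold setoidVec
  refine if_congr ?_ rfl rfl
  constructor
  · exact fun h => ⟨fun a b hab => (Prod.ext_iff.mp (he (h a b hab))).1,
      fun a b hab => (Prod.ext_iff.mp (he (h a b hab))).2⟩
  · exact fun h a b hab => by simp only [h.1 a b hab, h.2 a b hab]

theorem twistedFunctional_setoidVec_ne_zero {ι X : Type*} [Fintype ι] {e : ZMod 2 × ZMod 2 → X}
    (he : Function.Injective e) {r : Setoid ι} {α z : ι → ZMod 2}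
    (hz : ∀ x y, r x y → z x = z y)
    (hα : ∀ x, ∑ j ∈ Finset.univ.filter (fun j => r x j), α j = 0) :
    twistedFunctional e α z (setoidVec X r) ≠ 0 := by
  rw [twistedFunctional_apply]
  have hterm : ∀ y : ι → ZMod 2, parSign (∑ i, α i * y i) * setoidVec X r (fun i => e (y i, z i)) =
      ((if ∀ a b, r a b → y a = y b then 1 else 0 : ℕ) : ℂ) := by
    intro y
    rw [setoidVec_apply_prod he]
    by_cases hy : ∀ a b, r a b → y a = y b
    · have hs : ∑ i, α i * y i = 0 := by
        have h01 : ∀ i, α i * y i = if y i = 1 then α i else 0 := by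
          intro i
          generalize α i = a
          generalize y i = b
          revert a b
          decide
        rw [Finset.sum_congr rfl fun i _ => h01 i, ← Finset.sum_filter]
        refine sum_eq_zero_of_saturated r α hα _ fun j hj j' hjj' => ?_
        simp only [Finset.mem_filter, Finset.mem_univ, true_and] at hj ⊢
        rw [← hy j j' hjj', hj]
      rw [if_pos ⟨hy, hz⟩, if_pos hy, hs]
      simp [parSign]
    · rw [if_neg (fun h => hy h.1), if_neg hy]
      simp
  rw [Finset.sum_congr rfl fun y _ => hterm y, ← Nat.cast_sum, Nat.cast_ne_zero]
  refine (Finset.sum_pos' (fun _ _ => Nat.zero_le _) ⟨0, Finset.mem_univ _, ?_⟩).ne'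
  simp

theorem of_twistedFunctional_setoidVec_ne_zero {ι X : Type*} [Fintype ι]
    {e : ZMod 2 × ZMod 2 → X}
    (he : Function.Injective e) {r : Setoid ι} {α z : ι → ZMod 2}
    (h : twistedFunctional e α z (setoidVec X r) ≠ 0) :
    (∀ x y, r x y → z x = z y) ∧
      ∀ x, ∑ j ∈ Finset.univ.filter (fun j => r x j), α j = 0 := by
  rw [twistedFunctional_apply] at h
  constructor
  · by_contra hz
    refine h (Finset.sum_eq_zero fun y _ => ?_)
    rw [setoidVec_apply_prod he, if_neg (fun h' => hz h'.2), mul_zero]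
  · intro x
    by_contra hx
    have hx1 : ∑ j ∈ Finset.univ.filter (fun j => r x j), α j = 1 := by
      generalize ∑ j ∈ Finset.univ.filter (fun j => r x j), α j = a at *
      revert a
      decide
    refine h ?_
    set F : (ι → ZMod 2) → ℂ :=
      fun y => parSign (∑ i, α i * y i) * setoidVec X r (fun i => e (y i, z i)) with hF
    set u : ι → ZMod 2 := fun j => if r x j then 1 else 0 with hu
    have hflip : ∀ y, F (y + u) = - F y := by
      intro y
      have hs : ∑ i, α i * (y + u) i = ∑ i, α i * y i + 1 := by
        simp only [Pi.add_apply, mul_add, Finset.sum_add_distrib, hu, mul_ite, mul_one, mul_zero]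
        rw [← Finset.sum_filter, hx1]
      have hu' : ∀ a b, r a b → u a = u b := by
        intro a b hab
        simp only [hu]
        exact if_congr ⟨fun h => r.trans h hab, fun h => r.trans h (r.symm hab)⟩ rfl rfl
      have hv : setoidVec X r (fun i => e ((y + u) i, z i)) =
          setoidVec X r (fun i => e (y i, z i)) := by
        rw [setoidVec_apply_prod he, setoidVec_apply_prod he]
        congr 1
        refine propext (and_congr_left' (forall₃_congr fun a b hab => ?_))
        rw [Pi.add_apply, Pi.add_apply, hu' a b hab, add_left_inj]
      simp only [hF]
      rw [hs, hv, parSign_add_one, neg_mul]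
    have hneg : ∑ y, F y = - ∑ y, F y := by
      rw [← Finset.sum_neg_distrib, ← Equiv.sum_comp (Equiv.addRight u) F]
      exact Finset.sum_congr rfl fun y _ => hflip y
    exact self_eq_neg.mp hneg

theorem linearIndependent_setoidVec_of_isNoncrossing {κ X : Type*} [Fintype κ]
    {e : ZMod 2 × ZMod 2 → X} (he : Function.Injective e) (r : κ → Setoid ι)
    (hr : ∀ i, IsNoncrossing (r i)) (hinj : Function.Injective r) :
    LinearIndependent ℂ (fun i => setoidVec X (r i)) := by
  refine linearIndependent_of_triangular _
    (fun i => twistedFunctional e (endpointInd (r i)) (depthParity (r i)))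
    (fun i => toLex (endKey (r i))) ?_ ?_ ?_
  · intro i j hij
    exact hinj ((hr i).eq_of_endKey_eq (hr j) (toLex.injective hij))
  · exact fun i => twistedFunctional_setoidVec_ne_zero he (fun _ _ h => (hr i).depthParity_eq h)
      (sum_endpointInd_class (r i))
  · intro i j hij
    obtain ⟨h1, h2⟩ := of_twistedFunctional_setoidVec_ne_zero he hij
    exact (hr j).toLex_endKey_le h1 h2

end Noncrossing

/-! ### Crossings -/

section Crossing

variable {n : ℕ}

theorem PartRel.equivalence (p : Finpartition (Finset.univ : Finset (Fin n))) :
    Equivalence (PartRel p) where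
  refl x := by
    obtain ⟨B, hB, hx⟩ := p.exists_mem (Finset.mem_univ x)
    exact ⟨B, hB, hx, hx⟩
  symm := fun ⟨B, hB, hx, hy⟩ => ⟨B, hB, hy, hx⟩
  trans := by
    rintro x y z ⟨B, hB, hx, hy⟩ ⟨C, hC, hy', hz⟩
    obtain rfl := p.eq_of_mem_parts hB hC hy hy'
    exact ⟨B, hB, hx, hz⟩

/-- The block relation as a setoid. -/
def partSetoid (p : Finpartition (Finset.univ : Finset (Fin n))) : Setoid (Fin n) :=
  ⟨PartRel p, PartRel.equivalence p⟩

theorem mem_parts_iff_of_mem {p : Finpartition (Finset.univ : Finset (Fin n))} {B : Finset (Fin n)}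
    {x : Fin n} (hx : x ∈ B) : B ∈ p.parts ↔ ∀ y, y ∈ B ↔ PartRel p x y := by
  constructor
  · intro hB y
    constructor
    · exact fun hy => ⟨B, hB, hx, hy⟩
    · rintro ⟨C, hC, hxC, hyC⟩
      obtain rfl := p.eq_of_mem_parts hB hC hx hxC
      exact hyC
  · intro h
    obtain ⟨C, hC, hxC⟩ := p.exists_mem (Finset.mem_univ x)
    have : B = C := by
      ext y
      rw [h y]
      constructor
      · rintro ⟨D, hD, hxD, hyD⟩
        obtain rfl := p.eq_of_mem_parts hC hD hxC hxD
        exact hyD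
      · exact fun hy => ⟨C, hC, hxC, hy⟩
    exact this ▸ hC

theorem partSetoid_injective :
    Function.Injective (partSetoid : Finpartition (Finset.univ : Finset (Fin n)) → _) := by
  intro p q h
  have hrel : ∀ x y, PartRel p x y ↔ PartRel q x y := fun x y => by
    have := congrArg (fun s : Setoid (Fin n) => s x y) h
    exact iff_of_eq this
  ext B
  by_cases hne : B.Nonempty
  · obtain ⟨x, hx⟩ := hne
    simp only [mem_parts_iff_of_mem hx, hrel]
  · rw [Finset.not_nonempty_iff_eq_empty] at hne
    subst hne
    exact iff_of_false p.empty_notMem_parts q.empty_notMem_parts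

theorem quadruple_eq {a b c d a' b' c' d' : Fin n} (hab : a < b) (hbc : b < c) (hcd : c < d)
    (hab' : a' < b') (hbc' : b' < c') (hcd' : c' < d')
    (h : ({a, b, c, d} : Finset (Fin n)) = {a', b', c', d'}) :
    a = a' ∧ b = b' ∧ c = c' ∧ d = d' := by
  have h1 : ∀ x, (x = a ∨ x = b ∨ x = c ∨ x = d) ↔ (x = a' ∨ x = b' ∨ x = c' ∨ x = d') := by
    intro x
    simpa using Finset.ext_iff.mp h x
  have ha := (h1 a).mp (by simp)
  have hb := (h1 b).mp (by simp)
  have hc := (h1 c).mp (by simp)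
  have hd := (h1 d).mp (by simp)
  have ha' := (h1 a').mpr (by simp)
  have hd' := (h1 d').mpr (by simp)
  clear h h1
  omega

theorem mem_cr_quadruple {p : Finpartition (Finset.univ : Finset (Fin n))} {a b c d : Fin n}
    (hab : a < b) (hbc : b < c) (hcd : c < d) :
    {a, b, c, d} ∈ cr p ↔ PartRel p a c ∧ PartRel p b d ∧ ¬ PartRel p a b := by
  constructor
  · rintro ⟨a', b', c', d', hab', hbc', hcd', h, h1⟩
    obtain ⟨rfl, rfl, rfl, rfl⟩ := quadruple_eq hab hbc hcd hab' hbc' hcd' h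
    exact h1
  · exact fun h => ⟨a, b, c, d, hab, hbc, hcd, rfl, h⟩

/-- If a pair in a block separates two elements of another block, then these are related by every
partition with the same crossings, and they lie in crossings. -/
theorem rel_and_mem_crossers_of_separated {p q : Finpartition (Finset.univ : Finset (Fin n))}
    (hpq : cr p = cr q) {x y b d : Fin n} (hxy : PartRel p x y) (hbd : PartRel p b d)
    (hxb : ¬ PartRel p x b) (hbx : b < x) (hxd : x < d) (hy : ¬ (b < y ∧ y < d)) :
    PartRel q x y ∧ x ∈ crossers p ∧ y ∈ crossers p := by
  have hp := PartRel.equivalence p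
  have hq := PartRel.equivalence q
  have hyb : y ≠ b := by rintro rfl; exact hxb hxy
  have hyd : y ≠ d := by rintro rfl; exact hxb (hp.trans hxy (hp.symm hbd))
  by_cases hlt : y < b
  · have hmem : {y, b, x, d} ∈ cr p := (mem_cr_quadruple hlt hbx hxd).mpr
      ⟨hp.symm hxy, hbd, fun h => hxb (hp.trans hxy h)⟩
    have h := (mem_cr_quadruple hlt hbx hxd).mp (hpq ▸ hmem)
    exact ⟨hq.symm h.1, ⟨_, hmem, by simp⟩, ⟨_, hmem, by simp⟩⟩
  · have hdy : d < y := by omega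
    have hmem : {b, x, d, y} ∈ cr p := (mem_cr_quadruple hbx hxd hdy).mpr
      ⟨hbd, hxy, fun h => hxb (hp.symm h)⟩
    have h := (mem_cr_quadruple hbx hxd hdy).mp (hpq ▸ hmem)
    exact ⟨h.2.1, ⟨_, hmem, by simp⟩, ⟨_, hmem, by simp⟩⟩

theorem exists_separating_of_mem_crossers {p : Finpartition (Finset.univ : Finset (Fin n))}
    {x : Fin n} (hx : x ∈ crossers p) : ∃ c b d, PartRel p x c ∧ PartRel p b d ∧
      ¬ PartRel p x b ∧ ((b < x ∧ x < d) ↔ ¬ (b < c ∧ c < d)) := by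
  have hp := PartRel.equivalence p
  obtain ⟨κ, ⟨a, b, c, d, hab, hbc, hcd, rfl, hac, hbd, hn⟩, hx⟩ := hx
  simp only [Finset.mem_insert, Finset.mem_singleton] at hx
  rcases hx with rfl | rfl | rfl | rfl
  · exact ⟨c, b, d, hac, hbd, hn, by omega⟩
  · exact ⟨d, a, c, hbd, hac, fun h => hn (hp.symm h), by omega⟩
  · exact ⟨a, b, d, hp.symm hac, hbd, fun h => hn (hp.trans hac h), by omega⟩
  · exact ⟨b, a, c, hp.symm hbd, hac, fun h => hn (hp.symm (hp.trans hbd h)), by omega⟩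

theorem rel_and_mem_crossers_of_rel {p q : Finpartition (Finset.univ : Finset (Fin n))}
    (hpq : cr p = cr q) {x y : Fin n} (hx : x ∈ crossers p) (hxy : PartRel p x y) :
    PartRel q x y ∧ y ∈ crossers p := by
  have hp := PartRel.equivalence p
  have hq := PartRel.equivalence q
  obtain ⟨c, b, d, hxc, hbd, hxb, hsep⟩ := exists_separating_of_mem_crossers hx
  have sep : ∀ u v, PartRel p x u → PartRel p x v → (b < u ∧ u < d) → ¬ (b < v ∧ v < d) →
      PartRel q u v ∧ u ∈ crossers p ∧ v ∈ crossers p := fun u v hu hv hin hout =>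
    rel_and_mem_crossers_of_separated hpq (hp.trans (hp.symm hu) hv) hbd
      (fun h => hxb (hp.trans hu h)) hin.1 hin.2 hout
  by_cases hxin : b < x ∧ x < d
  · have hc := hsep.mp hxin
    by_cases hyin : b < y ∧ y < d
    · have h1 := sep x c (hp.refl x) hxc hxin hc
      have h2 := sep y c hxy hxc hyin hc
      exact ⟨hq.trans h1.1 (hq.symm h2.1), h2.2.1⟩
    · have h1 := sep x y (hp.refl x) hxy hxin hyin
      exact ⟨h1.1, h1.2.2⟩
  · have hc : b < c ∧ c < d := by
      by_contra hc
      exact hxin (hsep.mpr hc)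
    by_cases hyin : b < y ∧ y < d
    · have h1 := sep y x hxy (hp.refl x) hyin hxin
      exact ⟨hq.symm h1.1, h1.2.1⟩
    · have h1 := sep c x hxc (hp.refl x) hc hxin
      have h2 := sep c y hxc hxy hc hyin
      exact ⟨hq.trans (hq.symm h1.1) h2.1, h2.2.2⟩

theorem crossers_congr {p q : Finpartition (Finset.univ : Finset (Fin n))} (h : cr p = cr q) :
    crossers p = crossers q := by
  simp only [crossers, h]

theorem isNoncrossing_comap_compl_crossers (p : Finpartition (Finset.univ : Finset (Fin n)))
    {χ : Set (Fin n)} (hχ : crossers p = χ) :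
    IsNoncrossing ((partSetoid p).comap (Subtype.val : {x // x ∉ χ} → Fin n)) := by
  subst hχ
  intro a b c d hab hbc hcd hac hbd
  by_contra hn
  exact a.2 ⟨{a.1, b.1, c.1, d.1}, (mem_cr_quadruple hab hbc hcd).mpr ⟨hac, hbd, hn⟩, by simp⟩

theorem eq_of_comap_compl_crossers_eq {p q : Finpartition (Finset.univ : Finset (Fin n))}
    (hpq : cr p = cr q) {χ : Set (Fin n)} (hχ : crossers p = χ)
    (h : (partSetoid p).comap (Subtype.val : {x // x ∉ χ} → Fin n) =
      (partSetoid q).comap (Subtype.val : {x // x ∉ χ} → Fin n)) : p = q := by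
  have key : ∀ {p q : Finpartition (Finset.univ : Finset (Fin n))}, cr p = cr q →
      crossers p = χ → (partSetoid p).comap (Subtype.val : {x // x ∉ χ} → Fin n) =
      (partSetoid q).comap (Subtype.val : {x // x ∉ χ} → Fin n) →
      ∀ x y, PartRel p x y → PartRel q x y := by
    intro p q hpq hχ h x y hxy
    by_cases hx : x ∈ χ
    · exact (rel_and_mem_crossers_of_rel hpq (hχ ▸ hx) hxy).1
    have hy : y ∉ χ := fun hy =>
      hx (hχ ▸ (rel_and_mem_crossers_of_rel hpq (hχ ▸ hy) ((PartRel.equivalence p).symm hxy)).2)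
    have := congrArg (fun s : Setoid {x // x ∉ χ} => s ⟨x, hx⟩ ⟨y, hy⟩) h
    exact (iff_of_eq this).mp hxy
  apply partSetoid_injective
  ext x y
  exact ⟨key hpq hχ h x y, key hpq.symm (crossers_congr hpq ▸ hχ) h.symm x y⟩

theorem xi_extend_eq_setoidVec {N : ℕ} (p : Finpartition (Finset.univ : Finset (Fin n)))
    {χ : Set (Fin n)} (hχ : crossers p = χ) (t : Fin N) (y : {x // x ∉ χ} → Fin N) :
    xi N p (fun x => if hx : x ∉ χ then y ⟨x, hx⟩ else t) =
      setoidVec (Fin N) ((partSetoid p).comap (Subtype.val : {x // x ∉ χ} → Fin n)) y := by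
  unfold xi setoidVec
  congr 1
  refine propext ⟨fun h a b hab => ?_, fun h a b hab => ?_⟩
  · simpa [a.2, b.2] using h a.1 b.1 hab
  · have hiff : a ∈ χ ↔ b ∈ χ := by
      subst hχ
      exact ⟨fun ha => (rel_and_mem_crossers_of_rel rfl ha hab).2, fun hb =>
        (rel_and_mem_crossers_of_rel rfl hb ((PartRel.equivalence p).symm hab)).2⟩
    by_cases ha : a ∈ χ
    · simp [ha, hiff.mp ha]
    · have hb : b ∉ χ := fun hb => ha (hiff.mpr hb)
      simpa [ha, hb] using h ⟨a, ha⟩ ⟨b, hb⟩ hab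

end Crossing

/-- for `N ≥ 4`, distinct partitions of `[k]`, each with at least one
crossing and all with the same set of crossings, have linearly independent vectors
`ξ_p` in `((Fin k → Fin N) → ℂ)`. -/
theorem stmt9 {N k m : ℕ} (hN : 4 ≤ N)
    (p : Fin m → Finpartition (Finset.univ : Finset (Fin k)))
    (hinj : Function.Injective p)
    (hcross : ∀ i, (cr (p i)).Nonempty)
    (heq : ∀ i j, cr (p i) = cr (p j)) :
    LinearIndependent ℂ (fun i => xi N (p i)) := by
  rcases isEmpty_or_nonempty (Fin m) with hm | ⟨⟨i₀⟩⟩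
  · exact linearIndependent_empty_type
  have hχ : ∀ i, crossers (p i) = crossers (p i₀) := fun i => crossers_congr (heq i i₀)
  obtain ⟨e⟩ : Nonempty (ZMod 2 × ZMod 2 ↪ Fin N) :=
    Function.Embedding.nonempty_of_card_le (by simpa using hN)
  have hli := linearIndependent_setoidVec_of_isNoncrossing e.injective
    (fun i => (partSetoid (p i)).comap (Subtype.val : {x // x ∉ crossers (p i₀)} → Fin k))
    (fun i => isNoncrossing_comap_compl_crossers (p i) (hχ i))
    (fun i j hij => hinj (eq_of_comap_compl_crossers_eq (heq i j) (hχ i) hij))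
  refine LinearIndependent.of_comp (LinearMap.funLeft ℂ ℂ
    fun (y : {x // x ∉ crossers (p i₀)} → Fin N) (x : Fin k) =>
      if hx : x ∉ crossers (p i₀) then y ⟨x, hx⟩ else e 0) ?_
  convert hli using 1
  ext i y
  exact xi_extend_eq_setoidVec (p i) (hχ i) (e 0) y
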